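/- Uniqueness for the discrete complementarity (natural boundary) problem: if p and q both solve the discrete complementarity problem on Ω_D, then p(i,j) = q(i,j) for all (i,j) ∈ ℤ×ℤ. -/

import Mathlib

/-- The sum of the four coefficients. -/
noncomputable def Kcoef (k1 k2 k3 k4 : ℤ × ℤ → ℝ) (x : ℤ × ℤ) : ℝ :=
  k1 x + k2 x + k3 x + k4 x

/-- The discrete elliptic (Reynolds) operator on the integer grid. -/
noncomputable def Lop (k1 k2 k3 k4 : ℤ × ℤ → ℝ) (p : ℤ × ℤ → ℝ) (x : ℤ × ℤ) : ℝ :=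
  k1 x * p (x.1 + 1, x.2) + k2 x * p (x.1 - 1, x.2) +
  k3 x * p (x.1, x.2 + 1) + k4 x * p (x.1, x.2 - 1) -
  Kcoef k1 k2 k3 k4 x * p x


/-- `p` is a solution on `Ω` for data `D`: it vanishes outside `Ω` and satisfies the
discrete equation `L p = D` on `Ω`. -/
def IsSolutionOn (k1 k2 k3 k4 D : ℤ × ℤ → ℝ) (Ω : Set (ℤ × ℤ)) (p : ℤ × ℤ → ℝ) : Prop :=
  (∀ x ∉ Ω, p x = 0) ∧ (∀ x ∈ Ω, Lop k1 k2 k3 k4 p x = D x)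

/-- `p` solves the discrete complementarity (natural boundary) problem on `ΩD`. -/
def SolvesCP (k1 k2 k3 k4 D : ℤ × ℤ → ℝ) (ΩD : Set (ℤ × ℤ)) (p : ℤ × ℤ → ℝ) : Prop :=
  (∀ x ∉ ΩD, p x = 0) ∧ (∀ x, 0 ≤ p x) ∧
  (∀ x ∈ ΩD, Lop k1 k2 k3 k4 p x ≤ D x) ∧
  (∀ x, 0 < p x → Lop k1 k2 k3 k4 p x = D x)

/-- The operator `Lop` is a weighted sum of differences to the four neighbours. -/
theorem Lop_eq_sum_diff (k1 k2 k3 k4 p : ℤ × ℤ → ℝ) (x : ℤ × ℤ) :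
    Lop k1 k2 k3 k4 p x =
      k1 x * (p (x.1 + 1, x.2) - p x) + k2 x * (p (x.1 - 1, x.2) - p x) +
      k3 x * (p (x.1, x.2 + 1) - p x) + k4 x * (p (x.1, x.2 - 1) - p x) := by
  unfold Lop Kcoef
  ring

theorem Lop_sub (k1 k2 k3 k4 p q : ℤ × ℤ → ℝ) (x : ℤ × ℤ) :
    Lop k1 k2 k3 k4 (p - q) x = Lop k1 k2 k3 k4 p x - Lop k1 k2 k3 k4 q x := by
  simp only [Lop, Pi.sub_apply]
  ring

/-- Strong maximum principle, in one direction: if `0 ≤ Lop u x` at a maximum point `x` of `u`,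
then the maximum is also attained at the right neighbour of `x`. -/
theorem le_right_of_Lop_nonneg {k1 k2 k3 k4 u : ℤ × ℤ → ℝ} {x : ℤ × ℤ}
    (hk1 : 0 < k1 x) (hk2 : 0 ≤ k2 x) (hk3 : 0 ≤ k3 x) (hk4 : 0 ≤ k4 x)
    (hL : 0 ≤ Lop k1 k2 k3 k4 u x) (hmax : ∀ y, u y ≤ u x) :
    u x ≤ u (x.1 + 1, x.2) := by
  rw [Lop_eq_sum_diff] at hL
  have h2 := mul_nonpos_of_nonneg_of_nonpos hk2 (sub_nonpos.2 (hmax (x.1 - 1, x.2)))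
  have h3 := mul_nonpos_of_nonneg_of_nonpos hk3 (sub_nonpos.2 (hmax (x.1, x.2 + 1)))
  have h4 := mul_nonpos_of_nonneg_of_nonpos hk4 (sub_nonpos.2 (hmax (x.1, x.2 - 1)))
  exact sub_nonneg.1 (nonneg_of_mul_nonneg_right (by linarith) hk1)

/-- Weak maximum principle: a function vanishing outside a finite set, with `0 ≤ Lop u` wherever
it is positive, is nonpositive. -/
theorem nonpos_of_Lop_nonneg {k1 k2 k3 k4 u : ℤ × ℤ → ℝ}
    (hk1 : ∀ x, 0 < k1 x) (hk2 : ∀ x, 0 ≤ k2 x) (hk3 : ∀ x, 0 ≤ k3 x) (hk4 : ∀ x, 0 ≤ k4 x)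
    {Ω : Set (ℤ × ℤ)} (hΩ : Ω.Finite) (hu : ∀ x ∉ Ω, u x = 0)
    (hL : ∀ x, 0 < u x → 0 ≤ Lop k1 k2 k3 k4 u x) (x : ℤ × ℤ) : u x ≤ 0 := by
  by_contra! hx
  have mem_of_pos : ∀ y, 0 < u y → y ∈ Ω := fun y hy => by
    by_contra h
    exact hy.ne' (hu y h)
  obtain ⟨m, -, hm⟩ := Set.exists_max_image Ω u hΩ ⟨x, mem_of_pos x hx⟩
  have hm0 : 0 < u m := hx.trans_le (hm x (mem_of_pos x hx))
  have hmax : ∀ y, u y ≤ u m := fun y => by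
    by_cases hy : y ∈ Ω
    · exact hm y hy
    · exact (hu y hy).trans_le hm0.le
  obtain ⟨z, hz, hright⟩ := Set.exists_max_image {y | u m ≤ u y} Prod.fst
    (hΩ.subset fun y hy => mem_of_pos y (hm0.trans_le hy)) ⟨m, le_refl (u m)⟩
  have hstep := le_right_of_Lop_nonneg (hk1 z) (hk2 z) (hk3 z) (hk4 z)
    (hL z (hm0.trans_le hz)) fun y => (hmax y).trans hz
  have := hright (z.1 + 1, z.2) (le_trans hz hstep)
  simp at this

/-- Comparison of two solutions of the complementarity problem. -/
theorem SolvesCP.le {k1 k2 k3 k4 D p q : ℤ × ℤ → ℝ}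
    (hk1 : ∀ x, 0 < k1 x) (hk2 : ∀ x, 0 ≤ k2 x) (hk3 : ∀ x, 0 ≤ k3 x) (hk4 : ∀ x, 0 ≤ k4 x)
    {Ω : Set (ℤ × ℤ)} (hΩ : Ω.Finite)
    (hp : SolvesCP k1 k2 k3 k4 D Ω p) (hq : SolvesCP k1 k2 k3 k4 D Ω q) (x : ℤ × ℤ) :
    p x ≤ q x := by
  obtain ⟨hp_out, -, -, hp_eq⟩ := hp
  obtain ⟨hq_out, hq_nonneg, hq_le, -⟩ := hq
  refine sub_nonpos.1 (nonpos_of_Lop_nonneg (u := p - q) hk1 hk2 hk3 hk4 hΩ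
    (fun y hy => by simp [hp_out y hy, hq_out y hy]) (fun y hy => ?_) x)
  have hpy : 0 < p y := (hq_nonneg y).trans_lt (sub_pos.1 hy)
  have hyΩ : y ∈ Ω := by
    by_contra h
    exact hpy.ne' (hp_out y h)
  rw [Lop_sub, hp_eq y hpy]
  exact sub_nonneg.2 (hq_le y hyΩ)

/-- Uniqueness for the discrete complementarity (natural boundary) problem. -/
theorem CP_unique
    (k1 k2 k3 k4 : ℤ × ℤ → ℝ)
    (hk1 : ∀ x, 0 < k1 x) (hk2 : ∀ x, 0 < k2 x)
    (hk3 : ∀ x, 0 < k3 x) (hk4 : ∀ x, 0 < k4 x)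
    (D : ℤ × ℤ → ℝ)
    (ΩD : Set (ℤ × ℤ)) (hΩD : ΩD.Finite)
    (p q : ℤ × ℤ → ℝ)
    (hp : SolvesCP k1 k2 k3 k4 D ΩD p)
    (hq : SolvesCP k1 k2 k3 k4 D ΩD q) :
    ∀ x : ℤ × ℤ, p x = q x := by
  have h2 := fun x => (hk2 x).le
  have h3 := fun x => (hk3 x).le
  have h4 := fun x => (hk4 x).le
  exact fun x => le_antisymm (hp.le hk1 h2 h3 h4 hΩD hq x) (hq.le hk1 h2 h3 h4 hΩD hp x)
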